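/- arXiv:1906.07216 — 2 statements merged into one kernel-verified Lean document; each statement's English description precedes it below -/
import Mathlib

section
/- Let X be a finite group and let E be a normal elementary abelian 2-subgroup of X of order 16. Suppose there is an isomorphism ψ of X/E onto the alternating group Alt(6) such that, transporting the conjugation action of X/E on E through ψ, the group E is isomorphic as an Alt(6)-module to the 4-dimensional module M = W₀/⟨e⟩ over GF(2), where W₀ = {f : {1,…,6} → GF(2) : Σᵢ f(i) = 0} is the sum-zero submodule of the GF(2)-permutation module of Alt(6) on 6 points and e is the all-ones vector (M is the non-trivial irreducible part of the 6-point permutation module). Then X splits over E: there exists a subgroup H ≤ X with H ∩ E = 1 and HE = X. -/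
open Equiv

section FixedPointFreeAction

variable {X P : Type*} [Group X] [Group P] (π : X →* P) {g x y : X}

/-- If `g` centralizes no nontrivial element of the kernel, then all elements of the coset of `g`
are conjugate to `g` under the kernel. -/
theorem exists_conj_eq_of_map_eq [Finite X]
    (hg : ∀ e ∈ π.ker, g * e = e * g → e = 1) (hy : π y = π g) :
    ∃ a ∈ π.ker, a * y * a⁻¹ = g := by
  have hmem (a : π.ker) : (a : X)⁻¹ * g * a * g⁻¹ ∈ π.ker := by
    simp [MonoidHom.mem_ker, MonoidHom.mem_ker.1 a.2]
  have hinj : Function.Injective fun a : π.ker ↦ (⟨_, hmem a⟩ : π.ker) := by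
    intro a b hab
    have h : (a : X)⁻¹ * g * a = (b : X)⁻¹ * g * b := mul_right_cancel (congrArg Subtype.val hab)
    have := hg (a * (b : X)⁻¹) (π.ker.mul_mem a.2 (π.ker.inv_mem b.2)) <| by
      calc g * (a * (b : X)⁻¹) = a * ((a : X)⁻¹ * g * a) * (b : X)⁻¹ := by group
        _ = a * (b : X)⁻¹ * g := by rw [h]; group
    exact Subtype.ext (mul_inv_eq_one.1 this)
  obtain ⟨a, ha⟩ := (Finite.injective_iff_surjective.1 hinj)
    ⟨y * g⁻¹, by simp [MonoidHom.mem_ker, hy]⟩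
  have h : (a : X)⁻¹ * g * a = y := mul_right_cancel (congrArg Subtype.val ha)
  exact ⟨a, a.2, by rw [← h]; group⟩

theorem eq_of_map_eq_of_commute (hg : ∀ e ∈ π.ker, g * e = e * g → e = 1) (hxy : π x = π y)
    (hx : Commute g x) (hy : Commute g y) : x = y :=
  mul_inv_eq_one.1 (hg _ (by simp [MonoidHom.mem_ker, hxy]) (hx.mul_right hy.inv_right))

theorem pow_eq_one_of_map_pow_eq_one (hg : ∀ e ∈ π.ker, g * e = e * g → e = 1) {k : ℕ}
    (hk : π g ^ k = 1) : g ^ k = 1 :=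
  hg _ (by simp [MonoidHom.mem_ker, hk]) ((Commute.refl g).pow_right k)

end FixedPointFreeAction

/-- Relations presenting `Alt(6)` as a group with a `BN`-pair of rank one: `s`, `t`, `h` generate
the Borel subgroup `3² : 4`, and `w` inverts its complement `⟨h⟩`. -/
structure A6Relations {G : Type*} [Group G] (s t h w : G) : Prop where
  s_pow : s ^ 3 = 1
  t_pow : t ^ 3 = 1
  s_comm_t : s * t = t * s
  h_conj_s : h * s * h⁻¹ = t
  h_conj_t : h * t * h⁻¹ = s⁻¹
  h_pow : h ^ 4 = 1
  w_conj_h : w * h * w⁻¹ = h⁻¹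
  wst_pow : (w * s * t) ^ 3 = 1
  wsth_pow : (w * s * t * h⁻¹) ^ 5 = 1

namespace A6Relations

variable {G : Type*} [Group G] {s t h w : G}

/-- Normal form of the elements of the subgroup generated by `s`, `t`, `h`. -/
def BorelForm (s t h y : G) : Prop := ∃ i j k : ℕ, y = s ^ i * (t ^ j * h ^ k)

/-- Normal form coming from the Bruhat decomposition `G = B ∪ U w B`. -/
def BruhatForm (s t h w y : G) : Prop :=
  BorelForm s t h y ∨ ∃ i j : ℕ, ∃ n, BorelForm s t h n ∧ y = s ^ i * (t ^ j * (w * n))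

theorem bruhatForm_of_mem_closure (R : A6Relations s t h w) {y : G}
    (hy : y ∈ Subgroup.closure {s, t, h, w}) : BruhatForm s t h w y := by
  obtain ⟨hs, ht, hst, h1, h2, h4, hw, r3, r5⟩ := R
  have es : s⁻¹ = s * s := by
    rw [inv_eq_iff_mul_eq_one, ← hs]; simp only [pow_succ, pow_zero, one_mul, mul_assoc]
  have et : t⁻¹ = t * t := by
    rw [inv_eq_iff_mul_eq_one, ← ht]; simp only [pow_succ, pow_zero, one_mul, mul_assoc]
  have eh : h⁻¹ = h * (h * h) := by
    rw [inv_eq_iff_mul_eq_one, ← h4]; simp only [pow_succ, pow_zero, one_mul, mul_assoc]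
  have tail {a b : G} (e : a = b) (x : G) : a * x = b * x := congrArg (· * x) e
  have cs := tail hs
  have ct := tail ht
  have ch := tail h4
  have ts := tail hst.symm
  have hs' := tail (mul_inv_eq_iff_eq_mul.1 h1)
  have ht' := tail (mul_inv_eq_iff_eq_mul.1 h2)
  have hhw : h * w = w * h⁻¹ := by
    have := mul_inv_eq_iff_eq_mul.1 hw
    rw [eq_mul_inv_iff_mul_eq, mul_assoc, this]; group
  have hw' := tail hhw
  have hW' := tail (show h * w⁻¹ = w⁻¹ * h⁻¹ by rw [← hw]; group)
  have A : w * s * t * w = s⁻¹ * t⁻¹ * w⁻¹ * s⁻¹ * t⁻¹ := by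
    rw [← mul_inv_eq_one, ← r3]
    calc _ = w * s * t * w * t * s * w * (t * s) := by group
      _ = _ := by
        rw [mul_assoc _ t s, ← hst]; simp only [pow_succ, pow_zero, one_mul, mul_assoc]
  replace A := tail A
  have r5' := tail r5
  simp only [es, et, eh, mul_assoc, pow_succ, pow_zero, one_mul]
    at cs ct ch ts hs' ht' hw' hW' A r5'
  have Ww (x) : w⁻¹ * (w * x) = x := inv_mul_cancel_left w x
  have wW (x) : w * (w⁻¹ * x) = x := mul_inv_cancel_left w x
  have B (x) := congrArg (h * ·) (A (h * (h * (h * x))))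
  simp only [cs, ch, ts, hs', ht', hw', hW'] at B
  have C (x) := congrArg (h * ·) (B (h * (h * (h * x))))
  simp only [cs, ch, ts, hs', ht', hw', hW'] at C
  have D (x) := congrArg (h * ·) (C (h * (h * (h * x))))
  simp only [cs, ch, ts, hs', ht', hw', hW'] at D
  simp only [cs, ct, ch, ts, hs', ht', hw', A] at r5'
  have S2 (x) : w * (s * (s * (w * x))) = t * (t * (w * (s * (h * x)))) := by
    have := congrArg (fun y ↦ t * (t * (h * (h * (h * y)))))
      (r5' (h * (t * (w * (s * (s * (w * x)))))))
    simp only [cs, ct, ch, hs', ht', hw', Ww] at this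
    exact this.symm
  have T1 (x) := congrArg (h * ·) (S2 (h * (h * (h * x))))
  simp only [cs, ch, hs', ht', hw'] at T1
  have S1 (x) := congrArg (h * ·) (T1 (h * (h * (h * x))))
  simp only [cs, ch, hs', ht', hw'] at S1
  have T2 (x) := congrArg (h * ·) (S1 (h * (h * (h * x))))
  simp only [cs, ch, hs', ht', hw'] at T2
  have W2 : w⁻¹ = w := by
    have hconj : w⁻¹ * (t * (w * 1)) =
        w⁻¹ * (w⁻¹ * (s * (w * (t * (t * (h * (h * (h * 1)))))))) := by
      rw [← T1, Ww]
    have e := S1 (w⁻¹ * (t * (w * 1)))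
    rw [wW, A, hconj] at e
    simp only [cs, ch, hs', ht', hw', hW'] at e
    have e' := congrArg (t * ·) (D (s * (s * (h * (h * 1)))))
    simp only [cs, ch, ts, hs', ht'] at e'
    have e'' := e'.trans e
    simp only [mul_right_inj] at e''
    rw [← mul_assoc w⁻¹ w⁻¹, right_eq_mul, mul_eq_one_iff_eq_inv, inv_inv] at e''
    exact e''
  rw [W2] at A B C D Ww
  have Ns {n} (hn : BorelForm s t h n) : BorelForm s t h (s * n) := by
    obtain ⟨i, j, k, rfl⟩ := hn
    exact ⟨i + 1, j, k, by rw [pow_succ', mul_assoc]⟩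
  have hst' : Commute s t := hst
  have tsi (i : ℕ) (x : G) : t * (s ^ i * x) = s ^ i * (t * x) := by
    rw [← mul_assoc, ← (hst'.pow_left i).eq, mul_assoc]
  have Nt {n} (hn : BorelForm s t h n) : BorelForm s t h (t * n) := by
    obtain ⟨i, j, k, rfl⟩ := hn
    exact ⟨i, j + 1, k, by rw [tsi, pow_succ', mul_assoc]⟩
  have hU (i j : ℕ) (x : G) : h * (s ^ i * (t ^ j * x)) = s ^ (2 * j) * (t ^ i * (h * x)) := by
    have e1 : h * s ^ i * h⁻¹ = t ^ i := by rw [← conj_pow, h1]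
    have e2 : h * t ^ j * h⁻¹ = s ^ (2 * j) := by rw [← conj_pow, h2, es, ← sq, pow_mul]
    calc _ = h * s ^ i * h⁻¹ * (h * t ^ j * h⁻¹) * (h * x) := by group
      _ = _ := by rw [e1, e2, ← (hst'.pow_pow (2 * j) i).eq, mul_assoc]
  have Nh {n} (hn : BorelForm s t h n) : BorelForm s t h (h * n) := by
    obtain ⟨i, j, k, rfl⟩ := hn
    exact ⟨2 * j, i, k + 1, by rw [hU, pow_succ' h]⟩
  have Ps {y} (hy : BruhatForm s t h w y) : BruhatForm s t h w (s * y) := by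
    obtain hy | ⟨i, j, n, hn, rfl⟩ := hy
    · exact .inl (Ns hy)
    · exact .inr ⟨i + 1, j, n, hn, by rw [pow_succ', mul_assoc]⟩
  have Pt {y} (hy : BruhatForm s t h w y) : BruhatForm s t h w (t * y) := by
    obtain hy | ⟨i, j, n, hn, rfl⟩ := hy
    · exact .inl (Nt hy)
    · exact .inr ⟨i, j + 1, n, hn, by rw [tsi, pow_succ', mul_assoc]⟩
  have Ph {y} (hy : BruhatForm s t h w y) : BruhatForm s t h w (h * y) := by
    obtain hy | ⟨i, j, n, hn, rfl⟩ := hy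
    · exact .inl (Nh hy)
    · exact .inr ⟨2 * j, i, _, Nh (Nh (Nh hn)), by rw [hU, hw']⟩
  have Nw {n} (hn : BorelForm s t h n) : BruhatForm s t h w (w * n) :=
    .inr ⟨0, 0, n, hn, by simp⟩
  have Pw {y} (hy : BruhatForm s t h w y) : BruhatForm s t h w (w * y) := by
    obtain hy | ⟨i, j, n, hn, rfl⟩ := hy
    · exact Nw hy
    · rw [pow_eq_pow_mod i hs, pow_eq_pow_mod j ht]
      have hi := Nat.mod_lt i three_pos
      have hj := Nat.mod_lt j three_pos
      generalize i % 3 = i at *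
      generalize j % 3 = j at *
      interval_cases i <;> interval_cases j <;>
      simp only [pow_succ, pow_zero, one_mul, mul_assoc, A, B, C, D, S1, S2, T1, T2, Ww] <;>
      repeat' first
        | exact .inl hn | exact hn | apply Ps | apply Pt | apply Nw | apply Ns | apply Nt | apply Nh
  induction hy using Subgroup.closure_induction_left with
  | one => exact .inl ⟨0, 0, 0, by simp⟩
  | mul_left x hx y _ ih =>
    obtain rfl | rfl | rfl | rfl := hx
    exacts [Ps ih, Pt ih, Ph ih, Pw ih]
  | inv_mul_cancel x hx y _ ih =>
    obtain rfl | rfl | rfl | rfl := hx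
    · rw [es, mul_assoc]; exact Ps (Ps ih)
    · rw [et, mul_assoc]; exact Pt (Pt ih)
    · rw [eh, mul_assoc, mul_assoc]; exact Ph (Ph (Ph ih))
    · rw [W2]; exact Pw ih

end A6Relations

namespace A6

/-- `σ` has no nontrivial fixed vector on the sum-zero functions modulo constants. -/
def FixedPointFree (σ : Perm (Fin 6)) : Prop :=
  ∀ f : Fin 6 → ZMod 2, ∑ i, f i = 0 →
    (f ∘ ⇑σ⁻¹ + f = 0 ∨ f ∘ ⇑σ⁻¹ + f = fun _ ↦ 1) → f = 0 ∨ f = fun _ ↦ 1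

def permS : Perm (Fin 6) := swap 0 2 * swap 2 4

def permT : Perm (Fin 6) := swap 1 3 * swap 3 5

def permH : Perm (Fin 6) := swap 0 1 * swap 1 2 * swap 2 3 * swap 4 5

def permW : Perm (Fin 6) := swap 0 1 * swap 2 3

set_option maxRecDepth 100000 in
theorem relations : A6Relations permS permT permH permW := by
  constructor <;> decide

theorem generators_mem_alternatingGroup :
    permS ∈ alternatingGroup (Fin 6) ∧ permT ∈ alternatingGroup (Fin 6) ∧
      permH ∈ alternatingGroup (Fin 6) ∧ permW ∈ alternatingGroup (Fin 6) := by
  simp [Perm.mem_alternatingGroup, permS, permT, permH, permW]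

theorem isThreeCycle_permS : permS.IsThreeCycle := by
  rw [permS, swap_comm]
  exact Perm.isThreeCycle_swap_mul_swap_same (by decide) (by decide) (by decide)

set_option maxRecDepth 100000 in
theorem fixedPointFree_mul : FixedPointFree (permS * permT) := by
  unfold FixedPointFree; decide

set_option maxRecDepth 100000 in
theorem fixedPointFree_mul_inv : FixedPointFree (permT * permS⁻¹) := by
  unfold FixedPointFree; decide

set_option maxRecDepth 100000 in
theorem fixedPointFree_order_three : FixedPointFree (permW * permS * permT) := by
  unfold FixedPointFree; decide

set_option maxRecDepth 100000 in
theorem fixedPointFree_order_five : FixedPointFree (permW * permS * permT * permH⁻¹) := by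
  unfold FixedPointFree; decide

set_option maxRecDepth 100000 in
theorem exists_coboundary_permH (f : Fin 6 → ZMod 2) (hf : ∑ i, f i = 0)
    (hnorm : f + f ∘ permH + f ∘ permH ∘ permH + f ∘ permH ∘ permH ∘ permH = 0 ∨
      f + f ∘ permH + f ∘ permH ∘ permH + f ∘ permH ∘ permH ∘ permH = fun _ ↦ 1) :
    ∃ g : Fin 6 → ZMod 2, ∑ i, g i = 0 ∧
      (g + f + g ∘ permH = 0 ∨ g + f + g ∘ permH = fun _ ↦ 1) := by
  revert f; decide

set_option maxRecDepth 100000 in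
theorem borel_normalForm_injective : ∀ (i j : Fin 3) (k : Fin 4),
    permS ^ i.1 * (permT ^ j.1 * permH ^ k.1) = 1 → i = 0 ∧ j = 0 ∧ k = 0 := by
  decide

set_option maxRecDepth 100000 in
theorem bigCell_ne_one : ∀ (i j l m : Fin 3) (k : Fin 4),
    permS ^ i.1 * (permT ^ j.1 * (permW * (permS ^ l.1 * (permT ^ m.1 * permH ^ k.1)))) ≠ 1 := by
  decide

set_option maxRecDepth 100000 in
theorem two_transitive_words : ∀ a b : Fin 6, a ≠ b → ∃ (i : Fin 2) (j : Fin 4) (k : Fin 5),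
    (permH ^ j.1 * permS ^ i.1 * (permW * permT) ^ k.1) 4 = a ∧
      (permH ^ j.1 * permS ^ i.1 * (permW * permT) ^ k.1) 0 = b := by
  decide

theorem alternatingGroup_le (K : Subgroup (Perm (Fin 6))) (hs : permS ∈ K) (ht : permT ∈ K)
    (hh : permH ∈ K) (hw : permW ∈ K) : alternatingGroup (Fin 6) ≤ K := by
  have key (a b : Fin 6) (hab : a ≠ b) : ∃ g ∈ K, g 4 = a ∧ g 0 = b := by
    obtain ⟨i, j, k, h⟩ := two_transitive_words a b hab
    exact ⟨_, K.mul_mem (K.mul_mem (K.pow_mem hh _) (K.pow_mem hs _))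
      (K.pow_mem (K.mul_mem hw ht) _), h⟩
  have : MulAction.IsMultiplyPretransitive K (Fin 6) 2 := by
    rw [MulAction.is_two_pretransitive_iff]
    intro a b c d hab hcd
    obtain ⟨g, hg, rfl, rfl⟩ := key a b hab
    obtain ⟨g', hg', rfl, rfl⟩ := key c d hcd
    exact ⟨⟨g' * g⁻¹, K.mul_mem hg' (K.inv_mem hg)⟩, by simp [Subgroup.smul_def]⟩
  exact Perm.alternatingGroup_le_of_isPreprimitive_of_isThreeCycle_mem
    (MulAction.isPreprimitive_of_is_two_pretransitive this) isThreeCycle_permS hs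

variable {X : Type*} [Group X]

theorem isCompl_closure_ker (π : X →* Perm (Fin 6)) (hπ : π.range ≤ alternatingGroup (Fin 6))
    {s t h w : X} (R : A6Relations s t h w) (hs : π s = permS) (ht : π t = permT)
    (hh : π h = permH) (hw : π w = permW) :
    Subgroup.closure {s, t, h, w} ⊓ π.ker = ⊥ ∧ Subgroup.closure {s, t, h, w} ⊔ π.ker = ⊤ := by
  constructor
  · rw [eq_bot_iff]
    rintro y ⟨hy, hy1⟩
    have hy1 : π y = 1 := hy1
    rw [Subgroup.mem_bot]
    obtain ⟨i, j, k, rfl⟩ | ⟨i, j, _, ⟨l, m, k, rfl⟩, rfl⟩ := R.bruhatForm_of_mem_closure hy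
    · rw [pow_eq_pow_mod i R.s_pow, pow_eq_pow_mod j R.t_pow, pow_eq_pow_mod k R.h_pow] at hy1 ⊢
      simp only [map_mul, map_pow, hs, ht, hh] at hy1
      obtain ⟨hi, hj, hk⟩ := borel_normalForm_injective ⟨i % 3, Nat.mod_lt _ three_pos⟩
        ⟨j % 3, Nat.mod_lt _ three_pos⟩ ⟨k % 4, Nat.mod_lt _ four_pos⟩ hy1
      simp_all [Fin.ext_iff]
    · rw [pow_eq_pow_mod i R.s_pow, pow_eq_pow_mod j R.t_pow, pow_eq_pow_mod l R.s_pow,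
        pow_eq_pow_mod m R.t_pow, pow_eq_pow_mod k R.h_pow] at hy1
      simp only [map_mul, map_pow, hs, ht, hh, hw] at hy1
      exact (bigCell_ne_one ⟨i % 3, Nat.mod_lt _ three_pos⟩ ⟨j % 3, Nat.mod_lt _ three_pos⟩
        ⟨l % 3, Nat.mod_lt _ three_pos⟩ ⟨m % 3, Nat.mod_lt _ three_pos⟩
        ⟨k % 4, Nat.mod_lt _ four_pos⟩ hy1).elim
  · have hle : alternatingGroup (Fin 6) ≤ (Subgroup.closure {s, t, h, w}).map π :=
      alternatingGroup_le _ ⟨s, Subgroup.subset_closure (by simp), hs⟩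
        ⟨t, Subgroup.subset_closure (by simp), ht⟩ ⟨h, Subgroup.subset_closure (by simp), hh⟩
        ⟨w, Subgroup.subset_closure (by simp), hw⟩
    rw [← Subgroup.comap_map_eq, eq_top_iff]
    exact fun x _ ↦ hle (hπ ⟨x, rfl⟩)

theorem exists_lift_relations [Finite X] (π : X →* Perm (Fin 6))
    (hπ : alternatingGroup (Fin 6) ≤ π.range)
    (hfix : ∀ g, FixedPointFree (π g) → ∀ e ∈ π.ker, g * e = e * g → e = 1)
    (hcob : ∀ h, π h = permH → h ^ 4 = 1 → ∀ e ∈ π.ker, (e * h⁻¹) ^ 4 = 1 →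
      ∃ a ∈ π.ker, a * (e * h⁻¹) * a⁻¹ = h⁻¹) :
    ∃ s t h w : X, A6Relations s t h w ∧ π s = permS ∧ π t = permT ∧ π h = permH ∧
      π w = permW := by
  obtain ⟨hsA, htA, hhA, hwA⟩ := generators_mem_alternatingGroup
  obtain ⟨s₀, hs₀⟩ := hπ hsA
  obtain ⟨t₀, ht₀⟩ := hπ htA
  obtain ⟨h₀, hh₀⟩ := hπ hhA
  obtain ⟨w₀, hw₀⟩ := hπ hwA
  have R := relations
  obtain ⟨u, hu⟩ : ∃ u, π u = permS * permT := ⟨s₀ * t₀, by simp [hs₀, ht₀]⟩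
  have fu := hfix u (by rw [hu]; exact fixedPointFree_mul)
  obtain ⟨a, ha, hau⟩ := exists_conj_eq_of_map_eq π fu (y := s₀ * u * s₀⁻¹)
    (by
    rw [map_mul, map_mul, map_inv, hs₀, hu, mul_inv_eq_iff_eq_mul, mul_assoc, ← R.s_comm_t])
  obtain ⟨s, hs, hsu⟩ : ∃ s, π s = permS ∧ s * u = u * s :=
    ⟨a * s₀, by simp [MonoidHom.mem_ker.1 ha, hs₀], by
      rw [← mul_inv_eq_iff_eq_mul, mul_inv_rev]; simpa only [mul_assoc] using hau⟩
  obtain ⟨t, rfl⟩ : ∃ t, u = s * t := ⟨s⁻¹ * u, by group⟩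
  have ht : π t = permT := by simpa [hs] using hu
  have hst : s * t = t * s := by simpa [mul_assoc] using hsu
  have hus : Commute (s * t) s := hsu.symm
  have hut : Commute (s * t) t := Commute.mul_left hst (.refl t)
  have hs3 : s ^ 3 = 1 := eq_of_map_eq_of_commute π fu (by simp [hs, R.s_pow])
    (hus.pow_right 3) (.one_right _)
  have ht3 : t ^ 3 = 1 := eq_of_map_eq_of_commute π fu (by simp [ht, R.t_pow])
    (hut.pow_right 3) (.one_right _)
  have fv := hfix (t * s⁻¹) (by simpa [hs, ht] using fixedPointFree_mul_inv)
  obtain ⟨b, hb, hbu⟩ := exists_conj_eq_of_map_eq π fv (y := h₀ * (s * t) * h₀⁻¹) (by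
    simp only [map_mul, map_inv, hs, ht, hh₀, ← R.h_conj_t, ← R.h_conj_s]; group)
  obtain ⟨h, hh, hhu⟩ : ∃ h, π h = permH ∧ h * (s * t) * h⁻¹ = t * s⁻¹ :=
    ⟨b * h₀, by simp [MonoidHom.mem_ker.1 hb, hh₀], by rw [← hbu]; group⟩
  have hcs : h * s * h⁻¹ = t := eq_of_map_eq_of_commute π fv (by simp [hs, ht, hh, R.h_conj_s])
    (by rw [← hhu]; exact hus.map (MulAut.conj h))
    (Commute.mul_left (.refl t) (Commute.inv_left hst))
  have hct : h * t * h⁻¹ = s⁻¹ := by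
    rw [← conj_mul, hcs] at hhu
    exact mul_left_cancel hhu
  have hh4 : h ^ 4 = 1 := by
    refine eq_of_map_eq_of_commute π fu (by simp [hh, R.h_pow]) ?_ (.one_right _)
    have hs' : SemiconjBy h s t := mul_inv_eq_iff_eq_mul.1 hcs
    have ht' : SemiconjBy h t s⁻¹ := mul_inv_eq_iff_eq_mul.1 hct
    have hs2 : SemiconjBy (h * h) s s⁻¹ := ht'.mul_left hs'
    have ht2 : SemiconjBy (h * h) t t⁻¹ := hs'.inv_right.mul_left ht'
    have hs4 : SemiconjBy (h * h * (h * h)) s s := by simpa using hs2.inv_right.mul_left hs2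
    have ht4 : SemiconjBy (h * h * (h * h)) t t := by simpa using ht2.inv_right.mul_left ht2
    rw [show h ^ 4 = h * h * (h * h) by simp only [pow_succ, pow_zero, one_mul, mul_assoc]]
    exact (hs4.mul_right ht4).symm
  obtain ⟨c, hc, hcw⟩ := hcob h hh hh4 (w₀ * h * w₀⁻¹ * h)
    (by simp [MonoidHom.mem_ker, hw₀, hh, R.w_conj_h])
    (by rw [mul_inv_cancel_right, conj_pow, hh4]; group)
  obtain ⟨w, hw, hwh⟩ : ∃ w, π w = permW ∧ w * h * w⁻¹ = h⁻¹ :=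
    ⟨c * w₀, by simp [MonoidHom.mem_ker.1 hc, hw₀], by rw [← hcw]; group⟩
  refine ⟨s, t, h, w, ⟨hs3, ht3, hst, hcs, hct, hh4, hwh, ?_, ?_⟩, hs, ht, hh, hw⟩
  · refine pow_eq_one_of_map_pow_eq_one π (hfix _ ?_) ?_
    · simpa [hs, ht, hw] using fixedPointFree_order_three
    · simpa [hs, ht, hw] using R.wst_pow
  · refine pow_eq_one_of_map_pow_eq_one π (hfix _ ?_) ?_
    · simpa [hs, ht, hw, hh] using fixedPointFree_order_five
    · simpa [hs, ht, hw, hh] using R.wsth_pow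

end A6


/-- If `X` is a finite group with a normal elementary abelian subgroup `E` of
order 16, `X/E ≅ Alt(6)`, and `E` is isomorphic, as an `Alt(6)`-module (via the conjugation
action transported through `ψ`), to the quotient `W₀/⟨e⟩` of the sum-zero submodule `W₀` of the
`GF(2)`-permutation module of `Alt(6)` on 6 points by the all-ones vector `e` (this module
isomorphism being encoded by the equivariant surjection `Φ : W₀ → E` with kernel `{0, e}`),
then `X` splits over `E`. -/
theorem stmt0 {X : Type*} [Group X] [Finite X]
    (E : Subgroup X) (hEnorm : E.Normal)
    (hEexp : ∀ x ∈ E, x ^ 2 = 1)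
    (hEab : ∀ x ∈ E, ∀ y ∈ E, x * y = y * x)
    (hEcard : Nat.card E = 16)
    (ψ : (X ⧸ E) ≃* alternatingGroup (Fin 6))
    (Φ : (Fin 6 → ZMod 2) → X)
    (hΦmem : ∀ f : Fin 6 → ZMod 2, ∑ i, f i = 0 → Φ f ∈ E)
    (hΦhom : ∀ f g : Fin 6 → ZMod 2, ∑ i, f i = 0 → ∑ i, g i = 0 →
      Φ (f + g) = Φ f * Φ g)
    (hΦsurj : ∀ x ∈ E, ∃ f : Fin 6 → ZMod 2, ∑ i, f i = 0 ∧ Φ f = x)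
    (hΦker : ∀ f : Fin 6 → ZMod 2, ∑ i, f i = 0 →
      (Φ f = 1 ↔ f = 0 ∨ f = fun _ => 1))
    (hΦequiv : ∀ (x : X) (f : Fin 6 → ZMod 2), ∑ i, f i = 0 →
      x * Φ f * x⁻¹ = Φ (f ∘ ⇑(((ψ (QuotientGroup.mk x) : Equiv.Perm (Fin 6)))⁻¹))) :
    ∃ H : Subgroup X, H ⊓ E = ⊥ ∧ H ⊔ E = ⊤ := by
  let π : X →* Perm (Fin 6) := (alternatingGroup (Fin 6)).subtype.comp
    (ψ.toMonoidHom.comp (QuotientGroup.mk' E))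
  have hker : π.ker = E := by
    ext x
    simp [π, MonoidHom.mem_ker]
  have hrange : π.range = alternatingGroup (Fin 6) := by
    ext σ
    constructor
    · rintro ⟨x, rfl⟩
      exact (ψ x).2
    · intro hσ
      obtain ⟨x, hx⟩ := QuotientGroup.mk_surjective (ψ.symm ⟨σ, hσ⟩)
      exact ⟨x, by simp [π, hx]⟩
  have hequiv (x : X) (f : Fin 6 → ZMod 2) (hf : ∑ i, f i = 0) :
      x * Φ f * x⁻¹ = Φ (f ∘ ⇑(π x)⁻¹) := hΦequiv x f hf
  have hsum (σ : Perm (Fin 6)) {f : Fin 6 → ZMod 2} (hf : ∑ i, f i = 0) :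
      ∑ i, (f ∘ σ) i = 0 := (Equiv.sum_comp σ f).trans hf
  have hadd {f g : Fin 6 → ZMod 2} (hf : ∑ i, f i = 0) (hg : ∑ i, g i = 0) :
      ∑ i, (f + g) i = 0 := by simp [Finset.sum_add_distrib, hf, hg]
  have hΦsq (f : Fin 6 → ZMod 2) (hf : ∑ i, f i = 0) : Φ f * Φ f = 1 := by
    rw [← sq, hEexp _ (hΦmem f hf)]
  obtain ⟨s, t, h, w, R, hs, ht, hh, hw⟩ := A6.exists_lift_relations π hrange.ge (by
    intro g hg e he hcomm
    rw [hker] at he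
    obtain ⟨f, hf, rfl⟩ := hΦsurj e he
    refine (hΦker f hf).2 (hg f hf ((hΦker _ (hadd (hsum _ hf) hf)).1 ?_))
    rw [hΦhom _ _ (hsum _ hf) hf, ← hequiv g f hf, hcomm, mul_inv_cancel_right, hΦsq f hf]) (by
    intro h hh hh4 e he hpow
    rw [hker] at he ⊢
    obtain ⟨f, hf, rfl⟩ := hΦsurj e he
    have hconj (f : Fin 6 → ZMod 2) (hf : ∑ i, f i = 0) :
        h⁻¹ * Φ f = Φ (f ∘ A6.permH) * h⁻¹ := by
      have := hequiv h⁻¹ f hf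
      rwa [map_inv, inv_inv, hh, inv_inv, ← eq_mul_inv_iff_mul_eq] at this
    have h1 := hsum A6.permH hf
    have h2 := hsum A6.permH h1
    have h3 := hsum A6.permH h2
    obtain ⟨g, hg, hgf⟩ := A6.exists_coboundary_permH f hf <|
      (hΦker _ (hadd (hadd (hadd hf h1) h2) h3)).1 <| by
        rw [hΦhom _ _ (hadd (hadd hf h1) h2) h3, hΦhom _ _ (hadd hf h1) h2, hΦhom _ _ hf h1,
          ← hpow]
        have push {f : Fin 6 → ZMod 2} (hf : ∑ i, f i = 0) (x : X) :
            h⁻¹ * (Φ f * x) = Φ (f ∘ A6.permH) * (h⁻¹ * x) := by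
          rw [← mul_assoc, hconj f hf, mul_assoc]
        have hinv : h⁻¹ * (h⁻¹ * (h⁻¹ * h⁻¹)) = 1 := by
          simpa [pow_succ, mul_assoc] using congrArg (·⁻¹) hh4
        simp only [pow_succ, pow_zero, one_mul, mul_assoc, push hf, push h1, push h2, hinv,
          mul_one]
    refine ⟨Φ g, hΦmem g hg, ?_⟩
    have hone := (hΦker _ (hadd (hadd hg hf) (hsum A6.permH hg))).2 hgf
    rw [hΦhom _ _ (hadd hg hf) (hsum _ hg), hΦhom _ _ hg hf] at hone
    rw [← eq_inv_of_mul_eq_one_left (hΦsq g hg), mul_assoc, mul_assoc, hconj g hg, ← mul_assoc,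
      ← mul_assoc, hone, one_mul])
  refine ⟨Subgroup.closure {s, t, h, w}, ?_⟩
  rw [← hker]
  exact A6.isCompl_closure_ker π hrange.le R hs ht hh hw
end

section
/- Let p be a prime, q = p^a with a ≥ 1, and s ≥ 1. Let X be a finite group, N a normal subgroup of X, and T a Sylow p-subgroup of X such that X = NT and C_T(N) = 1. Assume N is isomorphic to the direct product of s copies of SL₂(F_q), the special linear group of degree 2 over the field with q elements. Then the p-rank of X is sa: every elementary abelian p-subgroup of X has order at most p^{sa}, and X contains an elementary abelian p-subgroup of order p^{sa}. -/
theorem mul_le_pow_self_of_two_le {n m : ℕ} (hn : n ≠ 0) (hm : 2 ≤ m) : n * m ≤ m ^ n := by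
  obtain ⟨k, rfl⟩ := Nat.exists_eq_succ_of_ne_zero hn
  rw [pow_succ]
  exact Nat.mul_le_mul_right m (Nat.lt_pow_self hm)

/-- A finite `p`-group acting on a finite field `F` of characteristic `p` by semilinear maps
satisfies `|M / C_M(F)| * |C_F(M)| ≤ |F|`. -/
theorem IsPGroup.index_ker_mul_card_fixedPoints_le_of_semilinear {p : ℕ} [Fact p.Prime]
    {F M : Type*} [Field F] [Finite F] [CharP F p] [Group M] [Finite M] [DistribMulAction M F]
    (hM : IsPGroup p M)
    (h : ∀ (m : M) (c x : F), (m • (1 : F)) * (m • (c * x)) = (m • c) * (m • x)) :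
    (MulAction.toPermHom M F).ker.index * Nat.card (MulAction.fixedPoints M F) ≤ Nat.card F := by
  have h1 (m : M) : m • (1 : F) ≠ 0 := fun h0 => one_ne_zero ((smul_eq_zero_iff_eq m).1 h0)
  have hmul (m n : M) (x : F) :
      (m * n) • x / (m * n) • (1 : F) = m • (n • x / n • (1 : F)) / m • (1 : F) := by
    have := h m (n • (1 : F)) (n • x / n • (1 : F))
    rw [mul_div_cancel₀ _ (h1 n)] at this
    rw [mul_smul, mul_smul, div_eq_div_iff (mul_smul m n (1 : F) ▸ h1 (m * n)) (h1 m)]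
    linear_combination this
  let σ : M →* RingAut F :=
    { toFun m :=
        { toFun x := m • x / m • (1 : F)
          invFun x := m⁻¹ • x / m⁻¹ • (1 : F)
          left_inv x := by simp [← hmul]
          right_inv x := by simp [← hmul]
          map_add' x y := by rw [smul_add, add_div]
          map_mul' x y := by
            have := h m x y
            field_simp [h1 m]
            linear_combination this }
      map_one' := by ext x; simp
      map_mul' m n := by ext x; exact hmul m n x }
  have hσ (m : M) (x : F) : σ m x = m • x / m • (1 : F) := rfl
  have hker : σ.ker ≤ (MulAction.toPermHom M F).ker := by
    intro m hm
    have hx (x : F) : m • x = x * m • (1 : F) := by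
      have := hσ m x
      rw [MonoidHom.mem_ker.1 hm, RingAut.one_apply, eq_div_iff (h1 m)] at this
      exact this.symm
    have hpow (k : ℕ) : m ^ k • (1 : F) = (m • (1 : F)) ^ k := by
      induction k with
      | zero => simp
      | succ k ih => rw [pow_succ', mul_smul, hx, ih, pow_succ]
    obtain ⟨k, hk⟩ := hM m
    have : ExpChar F p := .prime Fact.out
    have := hpow (p ^ k)
    rw [hk, one_smul] at this
    have hone : m • (1 : F) = 1 := by
      have e := (ExpChar.pow_prime_pow_mul_eq_one_iff p k 1 (m • (1 : F))).1
        (by simpa using this.symm)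
      simpa using e
    ext x
    simp [hx x, hone]
  have := Finite.of_surjective _ σ.rangeRestrict_surjective
  have := Fintype.ofFinite σ.range
  let k := FixedPoints.subfield σ.range F
  have hcard : Nat.card F = Nat.card k ^ Nat.card σ.range := by
    rw [Module.natCard_eq_pow_finrank (K := k), FixedPoints.finrank_eq_card,
      Nat.card_eq_fintype_card (α := σ.range)]
  have hfix : Nat.card (MulAction.fixedPoints M F) ≤ Nat.card k := by
    by_cases hv : ∃ v : F, v ≠ 0 ∧ v ∈ MulAction.fixedPoints M F
    · obtain ⟨v, hv0, hv⟩ := hv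
      have hmem (w : MulAction.fixedPoints M F) : (w : F) / v ∈ k := by
        rintro ⟨_, m, rfl⟩
        change σ m (w / v) = w / v
        rw [map_div₀, hσ, hσ, w.2 m, hv m, div_div_div_cancel_right₀ (h1 m)]
      refine Nat.card_le_card_of_injective (fun w => (⟨_, hmem w⟩ : k)) fun w w' hw => ?_
      have := congrArg Subtype.val hw
      exact Subtype.ext ((div_left_inj' hv0).1 this)
    · have : Subsingleton (MulAction.fixedPoints M F) := by
        push Not at hv
        refine ⟨fun x y => Subtype.ext ?_⟩
        rw [not_not.1 fun hx => hv x hx x.2, not_not.1 fun hy => hv y hy y.2]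
      exact Finite.card_le_one_iff_subsingleton.2 this |>.trans Finite.card_pos
  calc _ ≤ σ.ker.index * Nat.card k :=
        Nat.mul_le_mul (Subgroup.index_antitone hker) hfix
    _ ≤ Nat.card F := by
        rw [hcard, Subgroup.index_ker]
        exact mul_le_pow_self_of_two_le Finite.card_pos.ne' Finite.one_lt_card

/-- A finite abelian `p`-group `A` acting on `F ^ ι`, for `F` a finite field of characteristic `p`,
by monomial semilinear maps satisfies `|A / C_A(F ^ ι)| * |C_{F ^ ι}(A)| ≤ |F| ^ |ι|`. -/
theorem IsPGroup.index_ker_mul_card_fixedPoints_le_of_monomial {p : ℕ} [Fact p.Prime]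
    {F ι A : Type*} [Field F] [Finite F] [CharP F p] [Fintype ι] [DecidableEq ι]
    [CommGroup A] [Finite A] [DistribMulAction A (ι → F)] (hA : IsPGroup p A)
    (h : ∀ (a : A) (i : ι), ∃ (j : ι) (f : F → F),
      (∀ x, a • (Pi.single i x : ι → F) = Pi.single j (f x)) ∧
        ∀ c x, f 1 * f (c * x) = f c * f x) :
    (MulAction.toPermHom A (ι → F)).ker.index * Nat.card (MulAction.fixedPoints A (ι → F)) ≤
      Nat.card F ^ Fintype.card ι := by
  choose π f hf hsemi using h
  have single_inj (i : ι) {x y : F} (hxy : (Pi.single i x : ι → F) = Pi.single i y) : x = y :=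
    Pi.single_injective i hxy
  have hf1 (a : A) (i : ι) : f a i 1 ≠ 0 := by
    intro h0
    have := hf a i 1
    rw [h0, Pi.single_zero, smul_eq_zero_iff_eq, Pi.single_eq_zero_iff] at this
    exact one_ne_zero this
  have hπ {a : A} {i j : ι} {z : F} (hj : a • (Pi.single i 1 : ι → F) = Pi.single j z) :
      π a i = j := by
    rw [hf] at hj
    by_contra hne
    have := congrFun hj (π a i)
    rw [Pi.single_eq_same, Pi.single_eq_of_ne hne] at this
    exact hf1 a i this
  let _ : MulAction A ι :=
    { smul := π
      one_smul i := hπ (one_smul A _)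
      mul_smul a b i := hπ (z := f a (π b i) (f b i 1)) (by rw [mul_smul, hf, hf]; rfl) }
  have hfs (a : A) (i : ι) (x : F) :
      a • (Pi.single i x : ι → F) = Pi.single (a • i) (f a i x) := hf a i x
  have happly (a : A) (v : ι → F) (i : ι) : (a • v) (a • i) = f a i (v i) := by
    conv_lhs => rw [← Finset.univ_sum_single v, Finset.smul_sum, Finset.sum_apply]
    rw [Finset.sum_eq_single i (fun j _ hj => ?_) (by simp), hfs, Pi.single_eq_same]
    rw [hfs, Pi.single_eq_of_ne fun hij => hj (MulAction.injective a hij).symm]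
  have hstab (i : ι) (m : MulAction.stabilizer A i) (x : F) :
      (m : A) • (Pi.single i x : ι → F) = Pi.single i (f m i x) :=
    (hfs m i x).trans (congrArg (fun j => (Pi.single j (f m i x) : ι → F)) m.2)
  let act (i : ι) : DistribMulAction (MulAction.stabilizer A i) F :=
    { smul m x := f m i x
      one_smul x := single_inj i ((hstab i 1 x).symm.trans (one_smul A _))
      mul_smul m n x := single_inj i (by
        refine (hstab i (m * n) x).symm.trans ?_
        rw [Subgroup.coe_mul, mul_smul, hstab, hstab]; rfl)
      smul_zero m := single_inj i (by
        refine (hstab i m 0).symm.trans ?_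
        rw [Pi.single_zero, smul_zero])
      smul_add m x y := single_inj i (by
        refine (hstab i m (x + y)).symm.trans ?_
        rw [Pi.single_add, smul_add, hstab, hstab, ← Pi.single_add]; rfl) }
  let K (i : ι) : Subgroup A := ⨅ x : F, MulAction.stabilizer A (Pi.single i x : ι → F)
  have hKmem {i : ι} {a : A} : a ∈ K i ↔ ∀ x : F, a • (Pi.single i x : ι → F) = Pi.single i x := by
    simp [K, Subgroup.mem_iInf]
  have hKle (i : ι) : K i ≤ MulAction.stabilizer A i := fun a ha => hπ (hKmem.1 ha 1)
  have hlocal (i : ι) : (K i).index * Nat.card (MulAction.fixedPoints (MulAction.stabilizer A i) F) ≤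
      Nat.card F ^ Nat.card (MulAction.orbit A i) := by
    have key := (hA.to_subgroup (MulAction.stabilizer A i)
      ).index_ker_mul_card_fixedPoints_le_of_semilinear (F := F) fun m c x => hsemi m i c x
    have hker : (MulAction.toPermHom (MulAction.stabilizer A i) F).ker =
        (K i).subgroupOf (MulAction.stabilizer A i) := by
      ext m
      rw [Subgroup.mem_subgroupOf, hKmem, MonoidHom.mem_ker, Equiv.ext_iff]
      refine forall_congr' fun x => ?_
      rw [hstab, (Pi.single_injective i).eq_iff]
      rfl
    rw [hker] at key
    rw [← Subgroup.relIndex_mul_index (hKle i), MulAction.index_stabilizer, mul_right_comm]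
    refine (Nat.mul_le_mul_right _ key).trans ?_
    rw [mul_comm]
    refine mul_le_pow_self_of_two_le ?_ Finite.one_lt_card
    have : Nonempty (MulAction.orbit A i) := ⟨⟨i, MulAction.mem_orbit_self i⟩⟩
    exact Finite.card_pos.ne'
  let Ω := MulAction.orbitRel.Quotient A ι
  have := Fintype.ofFinite Ω
  have hrep (i : ι) : ∃ (ω : Ω) (a : A), a • ω.out = i := by
    refine ⟨Quotient.mk'' i, ?_⟩
    have : MulAction.orbitRel A ι i (Quotient.out (Quotient.mk'' i : Ω)) :=
      Quotient.exact (Quotient.out_eq _).symm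
    exact this
  have hindex : (MulAction.toPermHom A (ι → F)).ker.index ≤ ∏ ω : Ω, (K ω.out).index := by
    refine le_trans (Subgroup.index_antitone fun a ha => ?_) (Subgroup.index_iInf_le _)
    rw [Subgroup.mem_iInf] at ha
    have hsingle (i : ι) (x : F) : a • (Pi.single i x : ι → F) = Pi.single i x := by
      obtain ⟨ω, b, rfl⟩ := hrep i
      rw [← smul_inv_smul b (Pi.single _ x : ι → F), smul_comm a b, hfs b⁻¹, inv_smul_smul,
        hKmem.1 (ha ω)]
    ext1 v
    change a • v = v
    rw [← Finset.univ_sum_single v, Finset.smul_sum]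
    exact Finset.sum_congr rfl fun i _ => hsingle i (v i)
  have hfixed : Nat.card (MulAction.fixedPoints A (ι → F)) ≤
      ∏ ω : Ω, Nat.card (MulAction.fixedPoints (MulAction.stabilizer A ω.out) F) := by
    rw [← Nat.card_pi]
    refine Nat.card_le_card_of_injective (fun v ω => ⟨v.1 ω.out, fun m => ?_⟩) fun v w hvw => ?_
    · have := happly m v.1 ω.out
      rw [v.2, m.2] at this
      exact this.symm
    · refine Subtype.ext (funext fun i => ?_)
      obtain ⟨ω, a, rfl⟩ := hrep i
      have hω : v.1 ω.out = w.1 ω.out := congrArg Subtype.val (congrFun hvw ω)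
      rw [← v.2 a, ← w.2 a, happly, happly, hω]
  have hcard : Fintype.card ι = ∑ ω : Ω, Nat.card (MulAction.orbit A ω.out) := by
    rw [← Nat.card_eq_fintype_card, Nat.card_congr (MulAction.selfEquivSigmaOrbits A ι),
      Nat.card_sigma]
  calc _ ≤ _ := Nat.mul_le_mul hindex hfixed
    _ ≤ _ := by
      rw [← Finset.prod_mul_distrib, hcard, ← Finset.prod_pow_eq_pow_sum]
      exact Finset.prod_le_prod' fun ω _ => hlocal ω.out

section UnipotentMatrices

open scoped MatrixGroups Matrix

/-- The upper unitriangular matrix with upper right entry `x`. -/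
def upperUnip {F : Type*} [Field F] (x : F) : SL(2, F) :=
  ⟨!![1, x; 0, 1], by simp [Matrix.det_fin_two]⟩

/-- The lower unitriangular matrix with lower left entry `x`. -/
def lowerUnip {F : Type*} [Field F] (x : F) : SL(2, F) :=
  ⟨!![1, 0; x, 1], by simp [Matrix.det_fin_two]⟩

section SL2

variable {F : Type*} [Field F]

theorem sl2_eq_iff {g h : SL(2, F)} :
    g = h ↔ g 0 0 = h 0 0 ∧ g 0 1 = h 0 1 ∧ g 1 0 = h 1 0 ∧ g 1 1 = h 1 1 := by
  rw [Matrix.SpecialLinearGroup.ext_iff]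
  simp [Fin.forall_fin_two, and_assoc]

theorem sl2_det (g : SL(2, F)) : g 0 0 * g 1 1 - g 0 1 * g 1 0 = 1 := by
  rw [← Matrix.det_fin_two, g.det_coe]

theorem coe_upperUnip (x : F) : (upperUnip x : Matrix (Fin 2) (Fin 2) F) = !![1, x; 0, 1] := rfl

theorem coe_lowerUnip (x : F) : (lowerUnip x : Matrix (Fin 2) (Fin 2) F) = !![1, 0; x, 1] := rfl

theorem upperUnip_zero : upperUnip (0 : F) = 1 := by
  simp [sl2_eq_iff, coe_upperUnip]

theorem lowerUnip_zero : lowerUnip (0 : F) = 1 := by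
  simp [sl2_eq_iff, coe_lowerUnip]

theorem upperUnip_add (x y : F) : upperUnip (x + y) = upperUnip x * upperUnip y := by
  simp [sl2_eq_iff, coe_upperUnip, Matrix.mul_apply, add_comm]

theorem lowerUnip_add (x y : F) : lowerUnip (x + y) = lowerUnip x * lowerUnip y := by
  simp [sl2_eq_iff, coe_lowerUnip, Matrix.mul_apply]

theorem upperUnip_neg (x : F) : upperUnip (-x) = (upperUnip x)⁻¹ := by
  rw [eq_inv_iff_mul_eq_one, ← upperUnip_add, neg_add_cancel, upperUnip_zero]

theorem upperUnip_injective : Function.Injective (upperUnip : F → SL(2, F)) := fun x y h => by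
  simpa [coe_upperUnip] using (sl2_eq_iff.1 h).2.1

theorem upperUnip_mul_eq_mul_upperUnip_iff {g : SL(2, F)} {y z : F} :
    g * upperUnip y = upperUnip z * g ↔
      z * g 1 0 = 0 ∧ g 0 0 * y = z * g 1 1 ∧ g 1 0 * y = 0 := by
  simp only [sl2_eq_iff, Matrix.SpecialLinearGroup.coe_mul, coe_upperUnip, Matrix.mul_apply,
    Fin.sum_univ_two, Matrix.of_apply, Matrix.cons_val', Matrix.cons_val_zero,
    Matrix.cons_val_one, Matrix.cons_val_fin_one]
  grind

theorem commute_upperUnip_of_commute {g : SL(2, F)} {x y : F} (hx : x ≠ 0)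
    (h : Commute g (upperUnip x)) : Commute g (upperUnip y) := by
  have h := upperUnip_mul_eq_mul_upperUnip_iff.1 h.eq
  refine upperUnip_mul_eq_mul_upperUnip_iff.2 ?_
  grind

theorem not_commute_lowerUnip_upperUnip {x y : F} (hx : x ≠ 0) (hy : y ≠ 0) :
    ¬Commute (lowerUnip x) (upperUnip y) := fun h => by
  have h := upperUnip_mul_eq_mul_upperUnip_iff.1 h.eq
  simp [coe_lowerUnip, hx, hy] at h

theorem eq_sq_mul_of_mul_upperUnip {g : SL(2, F)} {y z : F}
    (h : g * upperUnip y = upperUnip z * g) : z = g 0 0 ^ 2 * y := by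
  have h := upperUnip_mul_eq_mul_upperUnip_iff.1 h
  have := sl2_det g
  grind

theorem exists_conj_upperUnip (c : F) (hc : c ≠ 0) : ∃ g : SL(2, F), ∀ x,
    g * upperUnip x = upperUnip (c ^ 2 * x) * g := by
  refine ⟨⟨!![c, 0; 0, c⁻¹], by simp [Matrix.det_fin_two, hc]⟩, fun x => ?_⟩
  refine upperUnip_mul_eq_mul_upperUnip_iff.2 ?_
  simp
  field_simp

/-- The unipotent elements `lowerUnip (-x⁻¹)` satisfy the braid relation with `upperUnip x`. -/
theorem braid_upperUnip_lowerUnip {x : F} (hx : x ≠ 0) :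
    upperUnip x * lowerUnip (-x⁻¹) * upperUnip x =
      lowerUnip (-x⁻¹) * upperUnip x * lowerUnip (-x⁻¹) := by
  simp [sl2_eq_iff, coe_upperUnip, coe_lowerUnip, Matrix.mul_apply, hx]

/-- Every solution `g ≠ upperUnip x` of the braid relation with `upperUnip x` is conjugate
to the standard one by an upper unitriangular matrix. -/
theorem exists_conj_lowerUnip_of_braid {x : F} (hx : x ≠ 0) {g : SL(2, F)} (hg : g ≠ upperUnip x)
    (h : upperUnip x * g * upperUnip x = g * upperUnip x * g) :
    ∃ w, g = upperUnip w * lowerUnip (-x⁻¹) * (upperUnip w)⁻¹ := by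
  refine ⟨(1 - g 0 0) * x, ?_⟩
  have hdet := sl2_det g
  rw [← upperUnip_neg]
  rw [Ne, sl2_eq_iff] at hg
  rw [sl2_eq_iff] at h ⊢
  simp only [Matrix.SpecialLinearGroup.coe_mul, coe_upperUnip, coe_lowerUnip, Matrix.mul_apply,
    Fin.sum_univ_two, Matrix.of_apply, Matrix.cons_val', Matrix.cons_val_zero,
    Matrix.cons_val_one, Matrix.cons_val_fin_one] at h hg ⊢
  generalize g 0 0 = a at *
  generalize g 0 1 = b at *
  generalize g 1 0 = c at *
  generalize g 1 1 = d at *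
  obtain ⟨h00, h01, h10, h11⟩ := h
  have hc : c ≠ 0 := by
    rintro rfl
    have hd : a * d = 1 := by linear_combination hdet
    have ha : a = 1 := by grind
    have hd : d = 1 := by grind
    exact hg ⟨ha, by grind, rfl, hd⟩
  have h1 : a + c * x + d = 1 := mul_left_cancel₀ hc (by linear_combination -h10)
  have h2 : c * x = -1 := by linear_combination h00 + a * h1 - hdet
  have hcx : c = -x⁻¹ := by field_simp; exact h2
  have hd : d = 2 - a := by linear_combination h1 - h2
  have hb : b * c = a * d - 1 := by linear_combination -hdet
  subst hd
  have hb' : b = (a * (2 - a) - 1) * (-x) := by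
    linear_combination (-x) * hb + b * h2
  subst hb' hcx
  refine ⟨?_, ?_, ?_, ?_⟩ <;> field_simp <;> ring

theorem eq_of_conj_lowerUnip_mul {w w' z x y : F} (hx : x ≠ 0) (hy : y ≠ 0)
    (h : upperUnip w * lowerUnip x * (upperUnip w)⁻¹ *
        (upperUnip w' * lowerUnip y * (upperUnip w')⁻¹) =
      upperUnip z * lowerUnip (x + y) * (upperUnip z)⁻¹) : w = w' := by
  have h := (sl2_eq_iff.1 h).2.2.1
  simp only [← upperUnip_neg, Matrix.SpecialLinearGroup.coe_mul, coe_upperUnip, coe_lowerUnip,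
    Matrix.mul_apply, Fin.sum_univ_two, Matrix.of_apply, Matrix.cons_val', Matrix.cons_val_zero,
    Matrix.cons_val_one, Matrix.cons_val_fin_one] at h
  have : x * y * (w - w') = 0 := by linear_combination -h
  grind

theorem sl2_mem_of_unip_mem {H : Subgroup SL(2, F)} (hu : ∀ x, upperUnip x ∈ H)
    (hl : ∀ x, lowerUnip x ∈ H) (g : SL(2, F)) : g ∈ H := by
  have key (g : SL(2, F)) (hg : g 1 0 ≠ 0) : g ∈ H := by
    have : g = upperUnip ((g 0 0 - 1) / g 1 0) * lowerUnip (g 1 0) *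
        upperUnip ((g 1 1 - 1) / g 1 0) := by
      have hdet := sl2_det g
      rw [sl2_eq_iff]
      simp only [Matrix.SpecialLinearGroup.coe_mul, coe_upperUnip, coe_lowerUnip, Matrix.mul_apply,
        Fin.sum_univ_two, Matrix.of_apply, Matrix.cons_val', Matrix.cons_val_zero,
        Matrix.cons_val_one, Matrix.cons_val_fin_one]
      refine ⟨?_, ?_, ?_, ?_⟩ <;> field_simp <;> grind
    rw [this]
    exact mul_mem (mul_mem (hu _) (hl _)) (hu _)
  by_cases hg : g 1 0 = 0
  · rw [← H.mul_mem_cancel_left (hl 1)]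
    refine key _ ?_
    have hdet := sl2_det g
    simp [coe_lowerUnip, Matrix.mul_apply, hg]
    grind
  · exact key g hg

end SL2

theorem IsPGroup.exists_eq_upperUnip {p : ℕ} [Fact p.Prime] {F : Type*} [Field F] [Finite F]
    [CharP F p] {Q : Subgroup SL(2, F)} (hQ : IsPGroup p Q) (h1 : upperUnip 1 ∈ Q)
    {g : SL(2, F)} (hg : g ∈ Q) : ∃ x, g = upperUnip x := by
  let _ : MulAction Q (Fin 2 → F) :=
    { smul h v := (h : SL(2, F)).1 *ᵥ v
      one_smul v := Matrix.one_mulVec v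
      mul_smul h k v := (Matrix.mulVec_mulVec v _ _).symm }
  have hsmul (h : SL(2, F)) (hh : h ∈ Q) (v : Fin 2 → F) :
      (⟨h, hh⟩ : Q) • v = (h : Matrix (Fin 2) (Fin 2) F) *ᵥ v := rfl
  have hdvd : p ∣ Nat.card (Fin 2 → F) := by
    have : Fintype F := Fintype.ofFinite F
    have hp : p ∣ Nat.card F := by
      rw [Nat.card_eq_fintype_card]
      exact (CharP.cast_eq_zero_iff F p _).1 (FiniteField.cast_card_eq_zero F)
    rw [Nat.card_fun]
    exact dvd_pow hp (by simp)
  obtain ⟨v, hv, hv0⟩ := hQ.exists_fixed_point_of_prime_dvd_card_of_fixed_point (Fin 2 → F) hdvd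
    (a := 0) fun h => Matrix.mulVec_zero _
  have hv1 : v 1 = 0 := by
    simpa [hsmul, coe_upperUnip, Matrix.mulVec, dotProduct] using congrFun (hv ⟨_, h1⟩) 0
  have hv00 : v 0 ≠ 0 := fun h => hv0 (by ext i; fin_cases i <;> simp [h, hv1])
  have hg0 := congrFun (hv ⟨g, hg⟩) 0
  have hg1 := congrFun (hv ⟨g, hg⟩) 1
  simp only [hsmul, Matrix.mulVec, dotProduct, Fin.sum_univ_two, hv1, mul_zero, add_zero] at hg0 hg1
  have h00 : g 0 0 = 1 := by simpa [hv00] using hg0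
  have h10 : g 1 0 = 0 := by simpa [hv00] using hg1
  have hdet := sl2_det g
  rw [h00, h10] at hdet
  refine ⟨g 0 1, sl2_eq_iff.2 ?_⟩
  simp [coe_upperUnip, h00, h10]
  linear_combination hdet

/-- The tuple of upper unitriangular matrices with upper right entries `v i`. -/
def upperUnipPi {ι F : Type*} [Field F] (v : ι → F) : ι → SL(2, F) := fun i => upperUnip (v i)

section Pi

variable {ι F : Type*} [Field F]

theorem upperUnipPi_add (v w : ι → F) : upperUnipPi (v + w) = upperUnipPi v * upperUnipPi w :=
  funext fun _ => upperUnip_add _ _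

theorem upperUnipPi_zero : upperUnipPi (0 : ι → F) = 1 :=
  funext fun _ => upperUnip_zero

theorem upperUnipPi_injective : Function.Injective (upperUnipPi : (ι → F) → ι → SL(2, F)) :=
  fun _ _ h => funext fun i => upperUnip_injective (congrFun h i)

theorem upperUnipPi_single [DecidableEq ι] (i : ι) (x : F) :
    upperUnipPi (Pi.single i x) = Pi.mulSingle i (upperUnip x) := by
  ext1 j
  rcases eq_or_ne j i with rfl | hj
  · simp [upperUnipPi]
  · simp [upperUnipPi, hj, upperUnip_zero]

/-- The centralizers of the `upperUnipPi v` are ordered by the supports of the `v`. -/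
theorem forall_commute_upperUnipPi_iff [DecidableEq ι] {v w : ι → F} :
    (∀ g, Commute g (upperUnipPi v) → Commute g (upperUnipPi w)) ↔
      ∀ i, w i ≠ 0 → v i ≠ 0 := by
  simp only [Pi.commute_iff]
  refine ⟨fun h i hw hv => ?_, fun h g hg i => ?_⟩
  · refine not_commute_lowerUnip_upperUnip one_ne_zero hw ?_
    have := h (Pi.mulSingle i (lowerUnip 1)) (fun j => ?_) i
    · simpa [upperUnipPi] using this
    · rcases eq_or_ne j i with rfl | hj
      · simp [upperUnipPi, hv, upperUnip_zero]
      · simp [hj]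
  · by_cases hw : w i = 0
    · simp [upperUnipPi, hw, upperUnip_zero]
    · exact commute_upperUnip_of_commute (h i hw) (hg i)

theorem eq_of_conj_upperUnipPi_eq [DecidableEq ι] {v w : ι → F}
    (h : ∀ g, upperUnipPi v * g * (upperUnipPi v)⁻¹ = upperUnipPi w * g * (upperUnipPi w)⁻¹) :
    v = w := by
  ext i
  have h := (sl2_eq_iff.1 (congrFun (h (Pi.mulSingle i (lowerUnip 1))) i)).1
  simpa [upperUnipPi, ← upperUnip_neg, coe_upperUnip, coe_lowerUnip, Matrix.mul_apply] using h

/-- An additive map on a finite field commuting with multiplication by squares up to scalars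
is semilinear. -/
theorem map_mul_of_forall_sq_mul [Finite F] (f : F →+ F)
    (hf : ∀ c : F, c ≠ 0 → ∃ d, ∀ x, f (c ^ 2 * x) = d * f x) (c x : F) :
    f 1 * f (c * x) = f c * f x := by
  have hsq (c : F) : ∃ d, ∀ x, f (c ^ 2 * x) = d * f x := by
    rcases eq_or_ne c 0 with rfl | hc
    · exact ⟨0, by simp⟩
    · exact hf c hc
  have hall : ∃ d, ∀ x, f (c * x) = d * f x := by
    by_cases h2 : ringChar F = 2
    · obtain ⟨b, rfl⟩ := FiniteField.isSquare_of_char_two h2 c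
      simpa [sq] using hsq b
    · have h2 : (2 : F) ≠ 0 := Ring.two_ne_zero h2
      obtain ⟨d, hd⟩ := hsq ((c + 1) / 2)
      obtain ⟨e, he⟩ := hsq ((c - 1) / 2)
      refine ⟨d - e, fun x => ?_⟩
      rw [sub_mul, ← hd, ← he, ← map_sub]
      congr 1
      field_simp
      ring
  obtain ⟨d, hd⟩ := hall
  have h1 := hd 1
  rw [mul_one] at h1
  rw [hd, h1]
  ring

/-- An automorphism of `SL₂(F) ^ ι` that preserves the upper unitriangular subgroup `F ^ ι`
acts on it as a monomial semilinear map. -/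
theorem exists_monomial_semilinear [Finite F] [DecidableEq ι] (t : MulAut (ι → SL(2, F)))
    (τ : (ι → F) ≃+ (ι → F)) (h : ∀ v, t (upperUnipPi v) = upperUnipPi (τ v)) (i : ι) :
    ∃ (j : ι) (f : F → F), (∀ x, τ (Pi.single i x) = Pi.single j (f x)) ∧
      ∀ c x, f 1 * f (c * x) = f c * f x := by
  have hsupp {v w : ι → F} :
      (∀ i, w i ≠ 0 → v i ≠ 0) ↔ ∀ i, τ w i ≠ 0 → τ v i ≠ 0 := by
    have hcomm (g k : ι → SL(2, F)) : Commute (t g) (t k) ↔ Commute g k := by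
      simp [commute_iff_eq, ← map_mul]
    rw [← forall_commute_upperUnipPi_iff, ← forall_commute_upperUnipPi_iff, ← h, ← h]
    refine Iff.trans ?_ t.surjective.forall.symm
    simp only [hcomm]
  have h1 : τ (Pi.single i 1) ≠ 0 := by simp
  obtain ⟨j, hj⟩ := Function.ne_iff.1 h1
  have hback : τ.symm (Pi.single j 1) ≠ 0 := by simp
  have hsub (k : ι) (hk : τ.symm (Pi.single j 1) k ≠ 0) : (Pi.single i 1 : ι → F) k ≠ 0 := by
    refine hsupp.2 (fun l hl => ?_) k hk
    rw [AddEquiv.apply_symm_apply] at hl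
    rcases eq_or_ne l j with rfl | hlj
    · exact hj
    · simp [hlj] at hl
  have hi : τ.symm (Pi.single j 1) i ≠ 0 := by
    obtain ⟨k, hk⟩ := Function.ne_iff.1 hback
    rcases eq_or_ne k i with rfl | hki
    · exact hk
    · exact absurd (hsub k hk) (by simp [hki])
  have hmono (x : F) : τ (Pi.single i x) = Pi.single j (τ (Pi.single i x) j) := by
    ext k
    rcases eq_or_ne k j with rfl | hkj
    · simp
    · rw [Pi.single_eq_of_ne hkj]
      by_contra hk
      have := (hsupp (v := τ.symm (Pi.single j 1)) (w := Pi.single i x)).1 (fun l hl => ?_) k hk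
      · simp [hkj] at this
      · rcases eq_or_ne l i with rfl | hli
        · exact hi
        · simp [hli] at hl
  refine ⟨j, fun x => τ (Pi.single i x) j, hmono, ?_⟩
  let f : F →+ F :=
    ((Pi.evalAddMonoidHom (fun _ : ι => F) j).comp τ.toAddMonoidHom).comp
      (AddMonoidHom.single (fun _ : ι => F) i)
  refine map_mul_of_forall_sq_mul f fun c hc => ?_
  obtain ⟨g, hg⟩ := exists_conj_upperUnip c hc
  refine ⟨t (Pi.mulSingle i g) j 0 0 ^ 2, fun x => eq_sq_mul_of_mul_upperUnip ?_⟩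
  have := congrArg t (congrArg (Pi.mulSingle (M := fun _ : ι => SL(2, F)) i) (hg x))
  rw [Pi.mulSingle_mul, Pi.mulSingle_mul, ← upperUnipPi_single, ← upperUnipPi_single, map_mul,
    map_mul, h, h] at this
  exact congrFun this j

/-- An automorphism of `SL₂(F) ^ ι` that centralizes the upper unitriangular subgroup `F ^ ι`
is conjugation by an element of that subgroup. -/
theorem exists_eq_conj_upperUnipPi [Finite ι] [DecidableEq ι] (t : MulAut (ι → SL(2, F)))
    (h : ∀ v, t (upperUnipPi v) = upperUnipPi v) :
    ∃ w, ∀ g, t g = upperUnipPi w * g * (upperUnipPi w)⁻¹ := by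
  have hlow (i : ι) (y : F) : ∃ w, t (Pi.mulSingle i (lowerUnip y)) =
      Pi.mulSingle i (upperUnip w * lowerUnip y * (upperUnip w)⁻¹) := by
    rcases eq_or_ne y 0 with rfl | hy
    · exact ⟨0, by simp [lowerUnip_zero]⟩
    obtain ⟨x, hx, rfl⟩ : ∃ x : F, x ≠ 0 ∧ y = -x⁻¹ :=
      ⟨-y⁻¹, by simpa using hy, by simp [inv_neg]⟩
    have hu : t (Pi.mulSingle i (upperUnip x)) = Pi.mulSingle i (upperUnip x) := by
      rw [← upperUnipPi_single, h]
    have hbraid := congrArg t (congrArg (Pi.mulSingle (M := fun _ : ι => SL(2, F)) i)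
      (braid_upperUnip_lowerUnip hx))
    simp only [Pi.mulSingle_mul, map_mul, hu] at hbraid
    set g := t (Pi.mulSingle i (lowerUnip (-x⁻¹))) with hg
    have hgj (j : ι) (hj : j ≠ i) : g j = 1 := by
      simpa [hj] using congrFun hbraid j
    have hgi : g = Pi.mulSingle i (g i) := by
      ext1 j
      rcases eq_or_ne j i with rfl | hj
      · simp
      · simp [hgj j hj, hj]
    have hne : g i ≠ upperUnip x := by
      intro he
      rw [he, ← hu, hg, t.injective.eq_iff, (Pi.mulSingle_injective i).eq_iff] at hgi
      have := (sl2_eq_iff.1 hgi).2.2.1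
      simp [coe_upperUnip, coe_lowerUnip, hx] at this
    obtain ⟨w, hw⟩ := exists_conj_lowerUnip_of_braid hx hne (by simpa using congrFun hbraid i)
    exact ⟨w, by rw [hgi, hw]⟩
  choose w hw using hlow
  have hconst (i : ι) (y : F) (hy : y ≠ 0) : w i y = w i 1 := by
    have := congrArg t (congrArg (Pi.mulSingle (M := fun _ : ι => SL(2, F)) i) (lowerUnip_add y 1))
    rw [Pi.mulSingle_mul, map_mul, hw, hw, hw, ← Pi.mulSingle_mul,
      (Pi.mulSingle_injective i).eq_iff] at this
    exact eq_of_conj_lowerUnip_mul hy one_ne_zero this.symm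
  let u := upperUnipPi fun i => w i 1
  refine ⟨fun i => w i 1, fun g => ?_⟩
  have hconj (i : ι) (x : SL(2, F)) : MulAut.conj u (Pi.mulSingle i x) =
      Pi.mulSingle i (upperUnip (w i 1) * x * (upperUnip (w i 1))⁻¹) := by
    ext1 j
    rcases eq_or_ne j i with rfl | hj
    · simp [u, upperUnipPi]
    · simp [hj]
  let H := t.toMonoidHom.eqLocus (MulAut.conj u).toMonoidHom
  suffices g ∈ H from this
  refine Subgroup.pi_mem_of_mulSingle_mem g fun i => ?_
  refine sl2_mem_of_unip_mem (H := H.comap (MonoidHom.mulSingle (fun _ : ι => SL(2, F)) i))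
    (fun x => ?_) (fun y => ?_) _
  · change t (Pi.mulSingle i (upperUnip x)) = MulAut.conj u (Pi.mulSingle i (upperUnip x))
    rw [hconj, ← upperUnipPi_single, h, upperUnipPi_single, ← upperUnip_add, add_comm,
      upperUnip_add, mul_inv_cancel_right]
  · change t (Pi.mulSingle i (lowerUnip y)) = MulAut.conj u (Pi.mulSingle i (lowerUnip y))
    rcases eq_or_ne y 0 with rfl | hy
    · simp [lowerUnip_zero]
    · rw [hconj, hw, hconst i y hy]

/-- A finite abelian `p`-group acting faithfully on `SL₂(F) ^ ι`, where `F` is a finite field of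
characteristic `p`, and preserving the upper unitriangular subgroup has order at most
`|F| ^ |ι|`. -/
theorem IsPGroup.card_le_of_preserves_upperUnipPi {p : ℕ} [Fact p.Prime] [Finite F] [CharP F p]
    [Fintype ι] [DecidableEq ι] {A : Type*} [CommGroup A] [Finite A] (hA : IsPGroup p A)
    (κ : A →* MulAut (ι → SL(2, F))) (hκ : Function.Injective κ)
    (h : ∀ a v, ∃ w, κ a (upperUnipPi v) = upperUnipPi w) :
    Nat.card A ≤ Nat.card F ^ Fintype.card ι := by
  choose φ hφ using h
  let _ : DistribMulAction A (ι → F) :=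
    { smul := φ
      one_smul v := upperUnipPi_injective (by
        refine (hφ 1 v).symm.trans ?_
        rw [map_one, MulAut.one_apply])
      mul_smul a b v := upperUnipPi_injective (by
        refine (hφ (a * b) v).symm.trans ?_
        rw [map_mul, MulAut.mul_apply, hφ, hφ]; rfl)
      smul_zero a := upperUnipPi_injective (by
        refine (hφ a 0).symm.trans ?_
        rw [upperUnipPi_zero, map_one])
      smul_add a v w := upperUnipPi_injective (by
        refine (hφ a (v + w)).symm.trans ?_
        rw [upperUnipPi_add, map_mul, hφ, hφ, ← upperUnipPi_add]; rfl) }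
  have hφ' (a : A) (v : ι → F) : κ a (upperUnipPi v) = upperUnipPi (a • v) := hφ a v
  have hker (a : (MulAction.toPermHom A (ι → F)).ker) :
      ∃ w, ∀ g, κ a g = upperUnipPi w * g * (upperUnipPi w)⁻¹ := by
    refine exists_eq_conj_upperUnipPi _ fun v => ?_
    rw [hφ']
    exact congrArg _ (congrArg (fun e : Equiv.Perm (ι → F) => e v) (MonoidHom.mem_ker.1 a.2))
  choose w hw using hker
  have hfixed (a : (MulAction.toPermHom A (ι → F)).ker) (b : A) : b • w a = w a := by
    refine eq_of_conj_upperUnipPi_eq fun g => ?_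
    obtain ⟨g, rfl⟩ := (κ b).surjective g
    rw [← hφ', ← map_inv, ← map_mul, ← map_mul, ← hw, ← hw, ← MulAut.mul_apply, ← MulAut.mul_apply,
      ← map_mul, ← map_mul, mul_comm]
  have hcard : Nat.card (MulAction.toPermHom A (ι → F)).ker ≤
      Nat.card (MulAction.fixedPoints A (ι → F)) := by
    refine Nat.card_le_card_of_injective (fun a => ⟨w a, hfixed a⟩) fun a b hab => ?_
    have hab : w a = w b := congrArg Subtype.val hab
    exact Subtype.ext (hκ (MulEquiv.ext fun g => by rw [hw, hw, hab]))
  rw [← (MulAction.toPermHom A (ι → F)).ker.index_mul_card]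
  exact (Nat.mul_le_mul_left _ hcard).trans
    (hA.index_ker_mul_card_fixedPoints_le_of_monomial fun a i =>
      exists_monomial_semilinear (κ a) (DistribMulAction.toAddEquiv (ι → F) a) (hφ' a) i)

end Pi

end UnipotentMatrices

/-- If a Sylow `p`-subgroup meets a normal subgroup `C` trivially, so does every other one. -/
theorem Sylow.eq_one_of_mem_of_inf_eq_bot {p : ℕ} [Fact p.Prime] {X : Type*} [Group X] [Finite X]
    {C : Subgroup X} [C.Normal] (T S : Sylow p X) (hT : (T : Subgroup X) ⊓ C = ⊥)
    {y : X} (hyS : y ∈ S) (hyC : y ∈ C) : y = 1 := by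
  obtain ⟨k, rfl⟩ := MulAction.exists_smul_eq X S T
  have hk : k * y * k⁻¹ ∈ ((k • S : Sylow p X) : Subgroup X) ⊓ C :=
    ⟨Subgroup.smul_mem_pointwise_smul y (MulAut.conj k) _ hyS,
      Subgroup.Normal.conj_mem inferInstance y hyC k⟩
  rwa [hT, Subgroup.mem_bot, conj_eq_one_iff] at hk


/-- Let `p` be a prime, `q = p^a` (`a ≥ 1`), `s ≥ 1`.  Let `X` be a finite
group, `N` a normal subgroup, `T` a Sylow `p`-subgroup with `X = NT` and `C_T(N) = 1`, and
suppose `N` is isomorphic to a direct product of `s` copies of `SL₂(F_q)`.  Then the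
`p`-rank of `X` is `sa`: every elementary abelian `p`-subgroup of `X` has order at most
`p^(s*a)` and this bound is attained. -/
theorem stmt8 {p : ℕ} [Fact p.Prime] (a s : ℕ) (ha : 1 ≤ a) (hs : 1 ≤ s)
    {X : Type*} [Group X] [Finite X]
    (N : Subgroup X) (hNnorm : N.Normal) (T : Sylow p X)
    (hXNT : N ⊔ (T : Subgroup X) = ⊤)
    (hCTN : (T : Subgroup X) ⊓ Subgroup.centralizer (N : Set X) = ⊥)
    (ψ : N ≃* (Fin s → Matrix.SpecialLinearGroup (Fin 2) (GaloisField p a))) :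
    (∀ A : Subgroup X, (∀ x ∈ A, x ^ p = 1) → (∀ x ∈ A, ∀ y ∈ A, x * y = y * x) →
      Nat.card A ≤ p ^ (s * a)) ∧
    (∃ A : Subgroup X, (∀ x ∈ A, x ^ p = 1) ∧ (∀ x ∈ A, ∀ y ∈ A, x * y = y * x) ∧
      Nat.card A = p ^ (s * a)) := by
  have := hNnorm
  have hcardF : Nat.card (GaloisField p a) = p ^ a := GaloisField.card p a (by omega)
  let F := GaloisField p a
  let U : Multiplicative (Fin s → F) →* X :=
    N.subtype.comp (ψ.symm.toMonoidHom.comp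
      { toFun := fun v => upperUnipPi v.toAdd
        map_one' := upperUnipPi_zero
        map_mul' := fun v w => upperUnipPi_add v.toAdd w.toAdd })
  have hU (v : Fin s → F) : U (Multiplicative.ofAdd v) = ψ.symm (upperUnipPi v) := rfl
  have hUinj : Function.Injective U := N.subtype_injective.comp
    (ψ.symm.injective.comp (upperUnipPi_injective.comp Multiplicative.toAdd.injective))
  have hpowU (v : Multiplicative (Fin s → F)) : v ^ p = 1 := by
    refine Multiplicative.toAdd.injective ?_
    rw [toAdd_pow, toAdd_one]
    ext i
    simp
  have hUpow : ∀ x ∈ U.range, x ^ p = 1 := by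
    rintro _ ⟨v, rfl⟩
    rw [← map_pow, hpowU, map_one]
  refine ⟨fun A hAp hAcomm => ?_, U.range, hUpow, ?_, ?_⟩
  · obtain ⟨S, hS⟩ := IsPGroup.exists_le_sylow (p := p) (P := U.range)
      fun x => ⟨1, Subtype.ext (by simpa using hUpow x x.2)⟩
    have hA : IsPGroup p A := fun x => ⟨1, Subtype.ext (by simpa using hAp x x.2)⟩
    obtain ⟨S₁, hS₁⟩ := hA.exists_le_sylow
    obtain ⟨g, rfl⟩ := MulAction.exists_smul_eq X S₁ S
    have hconj (x : A) : g * x * g⁻¹ ∈ (g • S₁ : Sylow p X) :=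
      Subgroup.smul_mem_pointwise_smul (x : X) (MulAut.conj g) _ (hS₁ x.2)
    let κ : A →* MulAut (Fin s → Matrix.SpecialLinearGroup (Fin 2) F) :=
      (MulAut.congr ψ).toMonoidHom.comp
        (MulAut.conjNormal.comp ((MulAut.conj g).toMonoidHom.comp A.subtype))
    have hκ (x : A) (n : N) : (ψ.symm (κ x (ψ n)) : X) = g * x * g⁻¹ * n * (g * x * g⁻¹)⁻¹ := by
      simp [κ, MulAut.congr, mul_assoc]
    have hκinj : Function.Injective κ := by
      refine (injective_iff_map_eq_one κ).2 fun x hx => ?_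
      have hone : g * (x : X) * g⁻¹ = 1 := by
        refine T.eq_one_of_mem_of_inf_eq_bot _ hCTN (hconj x) ?_
        refine Subgroup.mem_centralizer_iff.2 fun n hn => ?_
        have := hκ x ⟨n, hn⟩
        rw [hx, MulAut.one_apply, ψ.symm_apply_apply, eq_mul_inv_iff_mul_eq] at this
        exact this
      exact Subtype.ext (conj_eq_one_iff.1 hone)
    let Q := ((g • S₁ : Sylow p X) : Subgroup X).subgroupOf N |>.map ψ.toMonoidHom
    have hQ : IsPGroup p Q :=
      ((g • S₁ : Sylow p X).isPGroup'.comap_of_injective N.subtype N.subtype_injective).map _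
    have hQu (v : Fin s → F) : upperUnipPi v ∈ Q :=
      ⟨ψ.symm (upperUnipPi v), hS ⟨Multiplicative.ofAdd v, hU v⟩, ψ.apply_symm_apply _⟩
    have hQeq {k : Fin s → Matrix.SpecialLinearGroup (Fin 2) F} (hk : k ∈ Q) :
        ∃ w, k = upperUnipPi w := by
      have (i : Fin s) : ∃ x, k i = upperUnip x :=
        (hQ.map (Pi.evalMonoidHom _ i)).exists_eq_upperUnip ⟨_, hQu fun _ => 1, rfl⟩ ⟨k, hk, rfl⟩
      choose w hw using this
      exact ⟨w, funext hw⟩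
    let _ : CommGroup A :=
      { (inferInstance : Group A) with
        mul_comm := fun x y => Subtype.ext (hAcomm x x.2 y y.2) }
    have hmain := hA.card_le_of_preserves_upperUnipPi κ hκinj fun x v => by
      refine hQeq ⟨ψ.symm (κ x (upperUnipPi v)), ?_, ψ.apply_symm_apply _⟩
      have := hκ x (ψ.symm (upperUnipPi v))
      rw [ψ.apply_symm_apply] at this
      change (ψ.symm (κ x (upperUnipPi v)) : X) ∈ (g • S₁ : Sylow p X)
      rw [this]
      exact mul_mem (mul_mem (hconj x) (hS ⟨Multiplicative.ofAdd v, hU v⟩)) (inv_mem (hconj x))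
    rwa [hcardF, Fintype.card_fin, ← pow_mul, mul_comm] at hmain
  · rintro _ ⟨v, rfl⟩ _ ⟨w, rfl⟩
    rw [← map_mul, ← map_mul, mul_comm]
  · rw [← Nat.card_congr (MonoidHom.ofInjective hUinj).toEquiv,
      Nat.card_congr Multiplicative.toAdd, Nat.card_fun, hcardF, Nat.card_eq_fintype_card,
      Fintype.card_fin, ← pow_mul, mul_comm]
end
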